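/- For every angle θ with 0 < θ ≤ 0.0539·π, there exists a test path q ∈ P(Q_S, Q_{E₁}) whose action satisfies A(q) < (3/8)·16^{1/3}·[ (2π²)^{1/3} + 2·(2θ)^{2/3} ]. -/

import Mathlib

open Real MeasureTheory Set
open scoped ENNReal

noncomputable section

/-- Euclidean norm on `ℝ × ℝ` (row vectors in the plane). -/
def enorm2 (v : ℝ × ℝ) : ℝ := Real.sqrt (v.1 ^ 2 + v.2 ^ 2)

/-- Row vector multiplied on the right by the rotation matrix `R θ`
with rows `(cos θ, sin θ)` and `(-sin θ, cos θ)`. -/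
def rotV (θ : ℝ) (v : ℝ × ℝ) : ℝ × ℝ :=
  (v.1 * Real.cos θ - v.2 * Real.sin θ, v.1 * Real.sin θ + v.2 * Real.cos θ)

/-- `H¹([0,1],(ℝ²)⁴)`: absolutely continuous paths `[0,1] → (ℝ²)⁴` with
square-integrable derivative, recorded via an integrable (a.e.-)derivative `v`
together with the integral representation of `q`. -/
structure H1Path4 where
  q : ℝ → Fin 4 → ℝ × ℝ
  v : ℝ → Fin 4 → ℝ × ℝ
  hvInt : ∀ i : Fin 4, IntegrableOn (fun t => v t i) (Icc (0:ℝ) 1)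
  hrep : ∀ i : Fin 4, ∀ t ∈ Icc (0:ℝ) 1, q t i = q 0 i + ∫ s in (0:ℝ)..t, v s i
  hL2 : ∀ i : Fin 4, IntegrableOn (fun t => enorm2 (v t i) ^ 2) (Icc (0:ℝ) 1)

/-- Center of mass at the origin throughout `[0,1]` (the path lies in `χ`). -/
def H1Path4.inChi (p : H1Path4) : Prop := ∀ t ∈ Icc (0:ℝ) 1, ∑ i, p.q t i = 0

/-- The Lagrangian action functional `A`, with value `+∞` allowed. -/
def action (p : H1Path4) : ℝ≥0∞ :=
  ∫⁻ t in Icc (0:ℝ) 1,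
    (ENNReal.ofReal ((1/2) * ∑ i, enorm2 (p.v t i) ^ 2)
      + ∑ i : Fin 4, ∑ j ∈ Finset.univ.filter (fun j => i < j),
          (ENNReal.ofReal (enorm2 (p.q t i - p.q t j)))⁻¹)

/-- The starting boundary configuration set `Q_S` (double isosceles with order
constraints). -/
def QSset : Set (Fin 4 → ℝ × ℝ) :=
  { c | ∃ a₁ b₁ c₁ : ℝ, 0 ≤ b₁ ∧ 0 ≤ c₁ ∧
      c = ![(-a₁ - c₁, 0), (-a₁, 0), ((2*a₁ + c₁)/2, b₁), ((2*a₁ + c₁)/2, -b₁)] }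

/-- The ending boundary configuration set `Q_{E₁}`. -/
def QE1set (θ : ℝ) : Set (Fin 4 → ℝ × ℝ) :=
  { c | ∃ a₂ b₂ c₂ : ℝ, 0 ≤ b₂ ∧ 0 ≤ c₂ ∧
      c = fun i => rotV θ (![(-b₂, -a₂), (-c₂, a₂), (c₂, a₂), (b₂, -a₂)] i) }

/-- The ending boundary configuration set `Q_{E₂}`. -/
def QE2set (θ : ℝ) : Set (Fin 4 → ℝ × ℝ) :=
  { c | ∃ a₂ b₂ c₂ : ℝ, 0 ≤ b₂ ∧ 0 ≤ c₂ ∧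
      c = fun i => rotV θ (![(-a₂, -b₂), (-a₂, b₂), (a₂, c₂), (a₂, -c₂)] i) }

/-- Membership in the admissible class `P(Q_S, E)`. -/
def inAdm (E : Set (Fin 4 → ℝ × ℝ)) (p : H1Path4) : Prop :=
  p.inChi ∧ p.q 0 ∈ QSset ∧ p.q 1 ∈ E

/-- `p` is an action minimizer over `P(Q_S, E)`. -/
def isMin (E : Set (Fin 4 → ℝ × ℝ)) (p : H1Path4) : Prop :=
  inAdm E p ∧ ∀ p' : H1Path4, inAdm E p' → action p ≤ action p'

/-- The Newtonian equations of the equal-mass four-body problem, on a set `s`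
of times. -/
def newton (Q : ℝ → Fin 4 → ℝ × ℝ) (s : Set ℝ) : Prop :=
  ∀ i : Fin 4, ∀ t ∈ s,
    deriv (deriv (fun u => Q u i)) t =
      ∑ j ∈ Finset.univ.erase i, (1 / enorm2 (Q t j - Q t i) ^ 3) • (Q t j - Q t i)

/-- Planar four-body configuration made of a vector `A i` rotating with angular velocity `θ` and
a vector `(B i, C i)` rotating with angular velocity `ω`. -/
def epicyclePos (θ ω : ℝ) (A B C : Fin 4 → ℝ) (t : ℝ) (i : Fin 4) : ℝ × ℝ :=
  (A i * cos (θ * t) + B i * cos (ω * t) - C i * sin (ω * t),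
    A i * sin (θ * t) + B i * sin (ω * t) + C i * cos (ω * t))

/-- Velocity of `epicyclePos`. -/
def epicycleVel (θ ω : ℝ) (A B C : Fin 4 → ℝ) (t : ℝ) (i : Fin 4) : ℝ × ℝ :=
  (-(A i * θ * sin (θ * t)) - ω * (B i * sin (ω * t) + C i * cos (ω * t)),
    A i * θ * cos (θ * t) + ω * (B i * cos (ω * t) - C i * sin (ω * t)))

lemma hasDerivAt_epicyclePos (θ ω : ℝ) (A B C : Fin 4 → ℝ) (i : Fin 4) (t : ℝ) :
    HasDerivAt (fun t => epicyclePos θ ω A B C t i) (epicycleVel θ ω A B C t i) t := by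
  have lin : ∀ a : ℝ, HasDerivAt (fun t => a * t) a t := fun a => by
    simpa using (hasDerivAt_id t).const_mul a
  have hs : ∀ a : ℝ, HasDerivAt (fun t => sin (a * t)) (cos (a * t) * a) t := fun a => (lin a).sin
  have hc : ∀ a : ℝ, HasDerivAt (fun t => cos (a * t)) (-sin (a * t) * a) t := fun a => (lin a).cos
  refine HasDerivAt.prodMk ?_ ?_
  · exact ((((hc θ).const_mul (A i)).add ((hc ω).const_mul (B i))).sub
      ((hs ω).const_mul (C i))).congr_deriv (by ring)
  · exact ((((hs θ).const_mul (A i)).add ((hs ω).const_mul (B i))).add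
      ((hc ω).const_mul (C i))).congr_deriv (by ring)

lemma continuous_epicycleVel (θ ω : ℝ) (A B C : Fin 4 → ℝ) (i : Fin 4) :
    Continuous (fun t => epicycleVel θ ω A B C t i) := by
  unfold epicycleVel
  fun_prop

/-- The path `epicyclePos` as an element of `H1Path4`. -/
def epicyclePath (θ ω : ℝ) (A B C : Fin 4 → ℝ) : H1Path4 where
  q := epicyclePos θ ω A B C
  v := epicycleVel θ ω A B C
  hvInt i := (continuous_epicycleVel θ ω A B C i).continuousOn.integrableOn_Icc
  hrep i t _ := by
    rw [intervalIntegral.integral_eq_sub_of_hasDerivAt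
      (fun s _ => hasDerivAt_epicyclePos θ ω A B C i s)
      ((continuous_epicycleVel θ ω A B C i).intervalIntegrable 0 t)]
    abel
  hL2 i := by
    refine Continuous.integrableOn_Icc ?_
    have h := continuous_epicycleVel θ ω A B C i
    unfold enorm2
    fun_prop

lemma enorm2_sq (v : ℝ × ℝ) : enorm2 v ^ 2 = v.1 ^ 2 + v.2 ^ 2 :=
  Real.sq_sqrt (by positivity)

lemma enorm2_epicycleVel_sq (θ ω : ℝ) (A B C : Fin 4 → ℝ) (t : ℝ) (i : Fin 4) :
    enorm2 (epicycleVel θ ω A B C t i) ^ 2 =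
      A i ^ 2 * θ ^ 2 + ω ^ 2 * (B i ^ 2 + C i ^ 2)
        + 2 * θ * ω * A i * (B i * cos ((ω - θ) * t) - C i * sin ((ω - θ) * t)) := by
  rw [enorm2_sq, sub_mul, cos_sub, sin_sub]
  simp only [epicycleVel]
  linear_combination A i ^ 2 * θ ^ 2 * sin_sq_add_cos_sq (θ * t)
    + ω ^ 2 * (B i ^ 2 + C i ^ 2) * sin_sq_add_cos_sq (ω * t)

lemma enorm2_epicyclePos_sub (θ ω : ℝ) (A B C : Fin 4 → ℝ) (t : ℝ) (i j : Fin 4) :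
    enorm2 (epicyclePos θ ω A B C t i - epicyclePos θ ω A B C t j) =
      √((A i - A j) ^ 2 + (B i - B j) ^ 2 + (C i - C j) ^ 2
        + 2 * (A i - A j) * ((B i - B j) * cos ((ω - θ) * t)
          - (C i - C j) * sin ((ω - θ) * t))) := by
  unfold enorm2
  congr 1
  rw [sub_mul ω θ, cos_sub, sin_sub]
  simp only [epicyclePos, Prod.fst_sub, Prod.snd_sub]
  linear_combination (A i - A j) ^ 2 * sin_sq_add_cos_sq (θ * t)
    + ((B i - B j) ^ 2 + (C i - C j) ^ 2) * sin_sq_add_cos_sq (ω * t)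

/-- Two circular binaries of diameter `r`, at mutual distance `R`: the centres turn by `θ`, the
binaries by `π / 4 + θ`. -/
def binaryPath (θ R r : ℝ) : H1Path4 :=
  epicyclePath θ (π / 4 + θ) ![-R / 2, -R / 2, R / 2, R / 2] ![-r / 2, r / 2, 0, 0]
    ![0, 0, r / 2, -r / 2]

lemma binaryPath_inAdm {θ R r : ℝ} (hr : 0 ≤ r) (hrR : r ≤ R) :
    inAdm (QE1set θ) (binaryPath θ R r) := by
  refine ⟨fun t _ => ?_, ⟨R / 2 - r / 2, r / 2, r, by positivity, hr, ?_⟩,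
    ⟨r / 2 * (√2 / 2), R / 2 + r / 2 * (√2 / 2), R / 2 - r / 2 * (√2 / 2), ?_, ?_, ?_⟩⟩
  · ext <;> simp [binaryPath, epicyclePath, epicyclePos, Fin.sum_univ_four] <;> ring
  · funext i
    fin_cases i <;> ext <;> simp [binaryPath, epicyclePath, epicyclePos] <;> ring
  · have : 0 ≤ R := hr.trans hrR
    positivity
  · have : √2 / 2 ≤ 1 := by
      rw [div_le_one two_pos]
      exact Real.sqrt_le_iff.2 (by norm_num)
    nlinarith
  · funext i
    fin_cases i <;> ext <;>
      simp [binaryPath, epicyclePath, epicyclePos, rotV, cos_add, sin_add] <;> ring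

lemma inv_sqrt_one_sub_le {z : ℝ} (h0 : 0 ≤ z) (h1 : z ≤ 1 / 8) :
    (√(1 - z))⁻¹ ≤ 1 + z / 2 + 3 / 8 * z ^ 2 + 9 / 25 * z ^ 3 := by
  have hk : 0 < 1 + z / 2 + 3 / 8 * z ^ 2 + 9 / 25 * z ^ 3 := by positivity
  rw [inv_le_comm₀ (Real.sqrt_pos.2 (by linarith)) hk]
  refine Real.le_sqrt_of_sq_le ?_
  rw [inv_pow, inv_le_iff_one_le_mul₀ (by positivity)]
  have h : 0 ≤ z ^ 3 * (1 / 8 - z) := mul_nonneg (by positivity) (by linarith)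
  have h' : 0 ≤ z ^ 4 * (1 / 8 - z) := mul_nonneg (by positivity) (by linarith)
  have h2 : 0 ≤ z ^ 5 * (1 / 8 - z) := mul_nonneg (by positivity) (by linarith)
  have h3 : 0 ≤ z ^ 6 * (1 / 8 - z) := mul_nonneg (by positivity) (by linarith)
  nlinarith [pow_nonneg h0 3, pow_nonneg h0 4, pow_nonneg h0 5, pow_nonneg h0 6]

lemma inv_sqrt_add_inv_sqrt_le {y : ℝ} (hy : y ^ 2 ≤ 1 / 8) :
    (√(1 + y))⁻¹ + (√(1 - y))⁻¹ ≤
      2 * (1 + 3 / 8 * y ^ 2 + 35 / 128 * y ^ 4 + 27 / 100 * y ^ 6) := by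
  have h1 : 0 < 1 + y := by nlinarith
  have h2 : 0 < 1 - y := by nlinarith
  have e1 : (√(1 + y))⁻¹ ^ 2 = (1 + y)⁻¹ := by rw [inv_pow, Real.sq_sqrt h1.le]
  have e2 : (√(1 - y))⁻¹ ^ 2 = (1 - y)⁻¹ := by rw [inv_pow, Real.sq_sqrt h2.le]
  have e3 : (√(1 + y))⁻¹ * (√(1 - y))⁻¹ = (√(1 - y ^ 2))⁻¹ := by
    rw [← mul_inv, ← Real.sqrt_mul h1.le]
    congr 2
    ring
  have e4 : (1 + y)⁻¹ + (1 - y)⁻¹ = 2 * (√(1 - y ^ 2))⁻¹ ^ 2 := by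
    rw [inv_pow, Real.sq_sqrt (by linarith)]
    have : 1 - y ^ 2 ≠ 0 := by linarith
    field_simp
    ring
  have hk := inv_sqrt_one_sub_le (sq_nonneg y) hy
  have hk0 : 0 ≤ (√(1 - y ^ 2))⁻¹ := by positivity
  refine (pow_le_pow_iff_left₀ (by positivity) (by positivity) two_ne_zero).1 ?_
  have : ((√(1 + y))⁻¹ + (√(1 - y))⁻¹) ^ 2 =
      2 * (√(1 - y ^ 2))⁻¹ ^ 2 + 2 * (√(1 - y ^ 2))⁻¹ := by
    rw [← e4, ← e1, ← e2, ← e3]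
    ring
  rw [this]
  generalize (√(1 - y ^ 2))⁻¹ = k at *
  have hy4 : y ^ 4 = (y ^ 2) ^ 2 := by ring
  have hy6 : y ^ 6 = (y ^ 2) ^ 3 := by ring
  rw [hy4, hy6]
  have hz := sq_nonneg y
  generalize y ^ 2 = z at *
  have hkk := pow_le_pow_left₀ hk0 hk 2
  refine (add_le_add (mul_le_mul_of_nonneg_left hkk zero_le_two)
    (mul_le_mul_of_nonneg_left hk zero_le_two)).trans ?_
  have h : 0 ≤ z ^ 3 * (1 / 8 - z) := mul_nonneg (by positivity) (by linarith)
  have h' : 0 ≤ z ^ 4 * (1 / 8 - z) := mul_nonneg (by positivity) (by linarith)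
  have h2 : 0 ≤ z ^ 5 * (1 / 8 - z) := mul_nonneg (by positivity) (by linarith)
  nlinarith [pow_nonneg hz 3, pow_nonneg hz 4, pow_nonneg hz 5, pow_nonneg hz 6]

lemma sum_inv_sqrt_square_le {N x a b : ℝ} (hN : 0 < N) (hx : 2 * (x / N) ^ 2 ≤ 1 / 8)
    (hab : a ^ 2 + b ^ 2 = 1) :
    (√(N + x * (a + b)))⁻¹ + (√(N - x * (a + b)))⁻¹
        + ((√(N + x * (a - b)))⁻¹ + (√(N - x * (a - b)))⁻¹) ≤
      (√N)⁻¹ * (4 + 3 / 2 * (x / N) ^ 2 + 35 / 32 * (1 + (2 * a * b) ^ 2) * (x / N) ^ 4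
        + 27 / 25 * (1 + 3 * (2 * a * b) ^ 2) * (x / N) ^ 6) := by
  have key : ∀ p : ℝ, p ^ 2 ≤ 2 → (√(N + x * p))⁻¹ + (√(N - x * p))⁻¹ ≤ (√N)⁻¹ *
      (2 * (1 + 3 / 8 * (x / N * p) ^ 2 + 35 / 128 * (x / N * p) ^ 4
        + 27 / 100 * (x / N * p) ^ 6)) := fun p hp => by
    have e1 : N + x * p = N * (1 + x / N * p) := by field_simp
    have e2 : N - x * p = N * (1 - x / N * p) := by field_simp
    rw [e1, e2, Real.sqrt_mul hN.le, Real.sqrt_mul hN.le, mul_inv, mul_inv, ← mul_add]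
    refine mul_le_mul_of_nonneg_left (inv_sqrt_add_inv_sqrt_le ?_) (by positivity)
    rw [mul_pow]
    nlinarith [sq_nonneg (x / N)]
  refine (add_le_add (key (a + b) (by nlinarith [sq_nonneg (a - b)]))
    (key (a - b) (by nlinarith [sq_nonneg (a + b)]))).trans (le_of_eq ?_)
  generalize x / N = κ
  rw [← mul_add]
  congr 1
  have ha : a ^ 2 = 1 - b ^ 2 := by linarith
  have ha4 : a ^ 4 = (1 - b ^ 2) ^ 2 := by rw [← ha]; ring
  have ha6 : a ^ 6 = (1 - b ^ 2) ^ 3 := by rw [← ha]; ring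
  ring_nf
  rw [ha6, ha4, ha]
  ring

lemma ofReal_add_inv_eq {k d₁ d₂ d₃ d₄ d₅ d₆ : ℝ} (hk : 0 ≤ k) (h₁ : 0 < d₁) (h₂ : 0 < d₂)
    (h₃ : 0 < d₃) (h₄ : 0 < d₄) (h₅ : 0 < d₅) (h₆ : 0 < d₆) :
    ENNReal.ofReal k + ((ENNReal.ofReal d₁)⁻¹ + (ENNReal.ofReal d₂)⁻¹ + (ENNReal.ofReal d₃)⁻¹
      + ((ENNReal.ofReal d₄)⁻¹ + (ENNReal.ofReal d₅)⁻¹) + (ENNReal.ofReal d₆)⁻¹)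
      = ENNReal.ofReal (k + (d₁⁻¹ + d₂⁻¹ + d₃⁻¹ + (d₄⁻¹ + d₅⁻¹) + d₆⁻¹)) := by
  rw [← ENNReal.ofReal_inv_of_pos h₁, ← ENNReal.ofReal_inv_of_pos h₂,
    ← ENNReal.ofReal_inv_of_pos h₃, ← ENNReal.ofReal_inv_of_pos h₄,
    ← ENNReal.ofReal_inv_of_pos h₅, ← ENNReal.ofReal_inv_of_pos h₆,
    ← ENNReal.ofReal_add (by positivity) (by positivity),
    ← ENNReal.ofReal_add (by positivity) (by positivity),
    ← ENNReal.ofReal_add (by positivity) (by positivity),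
    ← ENNReal.ofReal_add (by positivity) (by positivity),
    ← ENNReal.ofReal_add (by positivity) (by positivity),
    ← ENNReal.ofReal_add (by positivity) (by positivity)]

lemma sum_filter_lt_fin_four (f : Fin 4 → Fin 4 → ℝ≥0∞) :
    ∑ i : Fin 4, ∑ j ∈ Finset.univ.filter (fun j => i < j), f i j
      = f 0 1 + f 0 2 + f 0 3 + (f 1 2 + f 1 3) + f 2 3 := by
  simp [Finset.sum_filter, Fin.sum_univ_four]

lemma kinetic_binaryPath (θ R r t : ℝ) :
    (1/2) * ∑ i, enorm2 ((binaryPath θ R r).v t i) ^ 2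
      = R ^ 2 * θ ^ 2 / 2 + r ^ 2 * (π / 4 + θ) ^ 2 / 2 := by
  have speed : ∀ i, enorm2 ((binaryPath θ R r).v t i) ^ 2 = _ :=
    enorm2_epicycleVel_sq θ (π / 4 + θ) _ _ _ t
  simp only [Fin.sum_univ_four, speed]
  simp
  ring

lemma lagrangian_binaryPath {θ R r t a b : ℝ} (hr : 0 < r)
    (ha : cos (π / 4 * t) = a) (hb : sin (π / 4 * t) = b)
    (hp : 0 < R ^ 2 + r ^ 2 / 2 + R * r * (a + b)) (hp' : 0 < R ^ 2 + r ^ 2 / 2 - R * r * (a + b))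
    (hm : 0 < R ^ 2 + r ^ 2 / 2 + R * r * (a - b))
    (hm' : 0 < R ^ 2 + r ^ 2 / 2 - R * r * (a - b)) :
    ENNReal.ofReal ((1/2) * ∑ i, enorm2 ((binaryPath θ R r).v t i) ^ 2)
      + ∑ i : Fin 4, ∑ j ∈ Finset.univ.filter (fun j => i < j),
        (ENNReal.ofReal (enorm2 ((binaryPath θ R r).q t i - (binaryPath θ R r).q t j)))⁻¹
    = ENNReal.ofReal (R ^ 2 * θ ^ 2 / 2 + r ^ 2 * (π / 4 + θ) ^ 2 / 2
      + (r⁻¹ + (√(R ^ 2 + r ^ 2 / 2 + R * r * (a - b)))⁻¹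
        + (√(R ^ 2 + r ^ 2 / 2 + R * r * (a + b)))⁻¹
        + ((√(R ^ 2 + r ^ 2 / 2 - R * r * (a + b)))⁻¹
          + (√(R ^ 2 + r ^ 2 / 2 - R * r * (a - b)))⁻¹) + r⁻¹)) := by
  have dist : ∀ i j, enorm2 ((binaryPath θ R r).q t i - (binaryPath θ R r).q t j) = _ :=
    enorm2_epicyclePos_sub θ (π / 4 + θ) _ _ _ t
  rw [add_sub_cancel_right, ha, hb] at dist
  have d01 : enorm2 ((binaryPath θ R r).q t 0 - (binaryPath θ R r).q t 1) = r := by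
    refine (dist _ _).trans (Eq.trans ?_ (Real.sqrt_sq hr.le)); congr 1; simp; ring
  have d23 : enorm2 ((binaryPath θ R r).q t 2 - (binaryPath θ R r).q t 3) = r := by
    refine (dist _ _).trans (Eq.trans ?_ (Real.sqrt_sq hr.le)); congr 1; simp; ring
  have d02 : enorm2 ((binaryPath θ R r).q t 0 - (binaryPath θ R r).q t 2)
      = √(R ^ 2 + r ^ 2 / 2 + R * r * (a - b)) := by
    rw [dist]; congr 1; simp; ring
  have d03 : enorm2 ((binaryPath θ R r).q t 0 - (binaryPath θ R r).q t 3)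
      = √(R ^ 2 + r ^ 2 / 2 + R * r * (a + b)) := by
    rw [dist]; congr 1; simp; ring
  have d12 : enorm2 ((binaryPath θ R r).q t 1 - (binaryPath θ R r).q t 2)
      = √(R ^ 2 + r ^ 2 / 2 - R * r * (a + b)) := by
    rw [dist]; congr 1; simp; ring
  have d13 : enorm2 ((binaryPath θ R r).q t 1 - (binaryPath θ R r).q t 3)
      = √(R ^ 2 + r ^ 2 / 2 - R * r * (a - b)) := by
    rw [dist]; congr 1; simp; ring
  rw [sum_filter_lt_fin_four, kinetic_binaryPath, d01, d02, d03, d12, d13, d23]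
  exact ofReal_add_inv_eq (by positivity) hr (Real.sqrt_pos.2 hm) (Real.sqrt_pos.2 hp)
    (Real.sqrt_pos.2 hp') (Real.sqrt_pos.2 hm') hr

lemma action_binaryPath_le {θ R r : ℝ} (hr : 0 < r) (hR : 0 < R)
    (hx : 2 * (R * r / (R ^ 2 + r ^ 2 / 2)) ^ 2 ≤ 1 / 8) :
    action (binaryPath θ R r) ≤ ENNReal.ofReal
      (R ^ 2 * θ ^ 2 / 2 + r ^ 2 * (π / 4 + θ) ^ 2 / 2 + 2 / r
        + (√(R ^ 2 + r ^ 2 / 2))⁻¹ * (4 + 3 / 2 * (R * r / (R ^ 2 + r ^ 2 / 2)) ^ 2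
          + 105 / 64 * (R * r / (R ^ 2 + r ^ 2 / 2)) ^ 4
          + 27 / 10 * (R * r / (R ^ 2 + r ^ 2 / 2)) ^ 6)) := by
  set N := R ^ 2 + r ^ 2 / 2 with hNdef
  have hN : 0 < N := by positivity
  set κ := R * r / N with hκ
  set K := R ^ 2 * θ ^ 2 / 2 + r ^ 2 * (π / 4 + θ) ^ 2 / 2 + 2 / r
    + (√N)⁻¹ * (4 + 3 / 2 * κ ^ 2 + 105 / 64 * κ ^ 4 + 27 / 10 * κ ^ 6) with hK
  set L := (√N)⁻¹ * (35 / 64 * κ ^ 4 + 81 / 50 * κ ^ 6) with hL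
  have pointwise : ∀ t : ℝ,
      ENNReal.ofReal ((1/2) * ∑ i, enorm2 ((binaryPath θ R r).v t i) ^ 2)
        + ∑ i : Fin 4, ∑ j ∈ Finset.univ.filter (fun j => i < j),
          (ENNReal.ofReal (enorm2 ((binaryPath θ R r).q t i - (binaryPath θ R r).q t j)))⁻¹
      ≤ ENNReal.ofReal (K - L * cos (π * t)) := by
    intro t
    have hab := cos_sq_add_sin_sq (π / 4 * t)
    have hS : (2 * cos (π / 4 * t) * sin (π / 4 * t)) ^ 2 = (1 - cos (π * t)) / 2 := by
      have h : cos (π * t) = 2 * (2 * cos (π / 4 * t) ^ 2 - 1) ^ 2 - 1 := by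
        rw [← cos_two_mul, ← cos_two_mul]
        congr 1
        ring
      rw [h, mul_pow, sin_sq]
      ring
    generalize ha : cos (π / 4 * t) = a at *
    generalize hb : sin (π / 4 * t) = b at *
    have hpos : ∀ p : ℝ, p ^ 2 ≤ 2 → 0 < N + R * r * p := fun p hp => by
      have e : N + R * r * p = N * (1 + κ * p) := by rw [hκ]; field_simp
      have : (κ * p) ^ 2 ≤ 1 / 8 := by rw [mul_pow]; nlinarith [sq_nonneg κ]
      rw [e]
      exact mul_pos hN (by nlinarith)
    have hp : (a + b) ^ 2 ≤ 2 := by nlinarith [sq_nonneg (a - b)]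
    have hm : (a - b) ^ 2 ≤ 2 := by nlinarith [sq_nonneg (a + b)]
    have hp' := hpos (-(a + b)) (by rwa [neg_sq])
    have hm' := hpos (-(a - b)) (by rwa [neg_sq])
    rw [mul_neg, ← sub_eq_add_neg] at hp' hm'
    rw [lagrangian_binaryPath hr ha hb (hpos _ hp) hp' (hpos _ hm) hm', ← hNdef]
    refine ENNReal.ofReal_le_ofReal ?_
    have cross := sum_inv_sqrt_square_le hN hx hab
    rw [hS, ← hκ] at cross
    rw [hK, hL, show 2 / r = r⁻¹ + r⁻¹ by ring]
    linarith
  have hint : ∫ t in Icc (0:ℝ) 1, (K - L * cos (π * t)) = K := by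
    rw [integral_Icc_eq_integral_Ioc, ← intervalIntegral.integral_of_le zero_le_one]
    have h : ∀ t : ℝ, HasDerivAt (fun t => K * t - L / π * sin (π * t))
        (K - L * cos (π * t)) t := fun t => by
      have lin : ∀ a : ℝ, HasDerivAt (fun t => a * t) a t := fun a => by
        simpa using (hasDerivAt_id t).const_mul a
      refine ((lin K).sub ((lin π).sin.const_mul (L / π))).congr_deriv ?_
      field_simp
    rw [intervalIntegral.integral_eq_sub_of_hasDerivAt (fun t _ => h t)
      (Continuous.intervalIntegrable (by fun_prop) _ _)]
    simp
  have hL0 : 0 ≤ L := by positivity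
  have hLK : L ≤ K := by
    have : 0 ≤ R ^ 2 * θ ^ 2 / 2 + r ^ 2 * (π / 4 + θ) ^ 2 / 2 + 2 / r
      + (√N)⁻¹ * (4 + 3 / 2 * κ ^ 2 + 70 / 64 * κ ^ 4 + 54 / 50 * κ ^ 6) := by positivity
    linarith
  rw [← hint, ofReal_integral_eq_lintegral_ofReal]
  · exact lintegral_mono pointwise
  · exact Continuous.integrableOn_Icc (by fun_prop)
  · exact Filter.Eventually.of_forall fun t => sub_nonneg.2
      ((mul_le_of_le_one_right hL0 (cos_le_one _)).trans hLK)

lemma inv_sqrt_mul_quadrupole_le {e : ℝ} (h0 : 0 ≤ e) (h1 : e ≤ 4 / 125) :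
    (√(1 + e))⁻¹ * (4 + 3 / 2 * (2 * e / (1 + e) ^ 2) + 105 / 64 * (2 * e / (1 + e) ^ 2) ^ 2
      + 27 / 10 * (2 * e / (1 + e) ^ 2) ^ 3) ≤ 4 + e + 4 / 5 * e ^ 2 := by
  have hs : (√(1 + e))⁻¹ ≤ 1 - e / 2 + 3 / 8 * e ^ 2 := by
    have hk : 0 < 1 - e / 2 + 3 / 8 * e ^ 2 := by nlinarith
    rw [inv_le_comm₀ (Real.sqrt_pos.2 (by linarith)) hk]
    refine Real.le_sqrt_of_sq_le ?_
    rw [inv_pow, inv_le_iff_one_le_mul₀ (by positivity)]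
    nlinarith [pow_nonneg h0 3, pow_nonneg h0 4, pow_nonneg h0 5,
      mul_nonneg (pow_nonneg h0 3) (sub_nonneg.2 h1)]
  have hw : 2 * e / (1 + e) ^ 2 ≤ 2 * e * (1 - 2 * e + 3 * e ^ 2) := by
    rw [div_le_iff₀ (by positivity)]
    nlinarith [pow_nonneg h0 3, pow_nonneg h0 4, pow_nonneg h0 5]
  have hw0 : 0 ≤ 2 * e / (1 + e) ^ 2 := by positivity
  generalize 2 * e / (1 + e) ^ 2 = w at *
  have hw2 := pow_le_pow_left₀ hw0 hw 2
  have hw3 : w ^ 3 ≤ (2 * e) ^ 3 := pow_le_pow_left₀ hw0 (hw.trans (by nlinarith)) 3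
  have hk : 0 ≤ 1 - e / 2 + 3 / 8 * e ^ 2 := by nlinarith
  calc _ ≤ (1 - e / 2 + 3 / 8 * e ^ 2) * (4 + 3 / 2 * (2 * e * (1 - 2 * e + 3 * e ^ 2))
        + 105 / 64 * (2 * e * (1 - 2 * e + 3 * e ^ 2)) ^ 2 + 27 / 10 * (2 * e) ^ 3) := by
        gcongr
    _ ≤ _ := by
        have h : ∀ n, 0 ≤ e ^ n * (4 / 125 - e) := fun n =>
          mul_nonneg (by positivity) (by linarith)
        nlinarith [h 2, h 3, h 4, h 5, h 6, h 7, pow_nonneg h0 2, pow_nonneg h0 3,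
          pow_nonneg h0 4, pow_nonneg h0 5, pow_nonneg h0 6, pow_nonneg h0 7, pow_nonneg h0 8]

lemma action_binaryPath_le_of_ratio {θ R r e : ℝ} (hr : 0 < r) (hR : 0 < R)
    (he : r ^ 2 = 2 * e * R ^ 2) (he0 : 0 ≤ e) (he1 : e ≤ 1 / 32) :
    action (binaryPath θ R r) ≤ ENNReal.ofReal
      (R ^ 2 * θ ^ 2 / 2 + r ^ 2 * (π / 4 + θ) ^ 2 / 2 + 2 / r
        + R⁻¹ * (4 + e + 4 / 5 * e ^ 2)) := by
  have hN : R ^ 2 + r ^ 2 / 2 = R ^ 2 * (1 + e) := by rw [he]; ring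
  have hκ : (R * r / (R ^ 2 + r ^ 2 / 2)) ^ 2 = 2 * e / (1 + e) ^ 2 := by
    rw [hN, div_pow, mul_pow, he]
    field_simp
  refine (action_binaryPath_le hr hR ?_).trans (ENNReal.ofReal_le_ofReal ?_)
  · rw [hκ, mul_div_assoc', div_le_iff₀ (by positivity)]
    nlinarith
  · have h4 : (R * r / (R ^ 2 + r ^ 2 / 2)) ^ 4 = (2 * e / (1 + e) ^ 2) ^ 2 := by
      rw [← hκ]; ring
    have h6 : (R * r / (R ^ 2 + r ^ 2 / 2)) ^ 6 = (2 * e / (1 + e) ^ 2) ^ 3 := by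
      rw [← hκ]; ring
    rw [hκ, h4, h6, hN, Real.sqrt_mul (sq_nonneg R), Real.sqrt_sq hR.le, mul_inv, mul_assoc]
    gcongr
    exact inv_sqrt_mul_quadrupole_le he0 (he1.trans (by norm_num))

lemma rpow_bound_le {τ : ℝ} (hτ : 0 < τ) :
    (3/8) * (6.81 + 8 * τ ^ 2) ≤ (3/8) * (16:ℝ) ^ ((1:ℝ)/3) *
      ((2 * π^2) ^ ((1:ℝ)/3) + 2 * (2*τ ^ 3) ^ ((2:ℝ)/3)) := by
  have cbrt : ∀ x : ℝ, 0 ≤ x → (x ^ 3) ^ ((1:ℝ)/3) = x := fun x hx => by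
    rw [← Real.rpow_natCast, ← Real.rpow_mul hx]
    norm_num
  have h1 : 6.81 ≤ (16:ℝ) ^ ((1:ℝ)/3) * (2 * π^2) ^ ((1:ℝ)/3) := by
    rw [← Real.mul_rpow (by norm_num) (by positivity), ← cbrt 6.81 (by norm_num)]
    refine Real.rpow_le_rpow (by norm_num) ?_ (by norm_num)
    nlinarith [Real.pi_gt_d6]
  have h2 : (16:ℝ) ^ ((1:ℝ)/3) * (2*τ ^ 3) ^ ((2:ℝ)/3) = 4 * τ ^ 2 := by
    rw [show (2:ℝ) / 3 = (2:ℕ) * (1 / 3) by norm_num, Real.rpow_mul (by positivity),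
      Real.rpow_natCast, ← Real.mul_rpow (by norm_num) (by positivity),
      ← cbrt (4 * τ ^ 2) (by positivity)]
    congr 1
    ring
  linarith

/-- for `0 < θ ≤ 0.0539·π`, there is a test path in `P(Q_S, Q_{E₁})`
whose action is strictly below `(3/8)·16^{1/3}·[(2π²)^{1/3} + 2(2θ)^{2/3}]`. -/
theorem statement18 (θ : ℝ) (hθ0 : 0 < θ) (hθ1 : θ ≤ 0.0539 * π) :
    ∃ p : H1Path4, inAdm (QE1set θ) p ∧
      action p < ENNReal.ofReal ((3/8) * (16:ℝ) ^ ((1:ℝ)/3) *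
        ((2 * π^2) ^ ((1:ℝ)/3) + 2 * (2*θ) ^ ((2:ℝ)/3))) := by
  obtain ⟨τ, hτ, rfl⟩ : ∃ τ : ℝ, 0 < τ ∧ τ ^ 3 = θ :=
    ⟨θ ^ ((1:ℝ)/3), by positivity, by
      rw [← Real.rpow_natCast, ← Real.rpow_mul hθ0.le]
      norm_num⟩
  have hπ := Real.pi_lt_d6
  have hτ1 : τ ≤ 0.55324 := by
    refine (pow_le_pow_iff_left₀ hτ.le (by norm_num) three_ne_zero).1 ?_
    linarith
  have hτ2 : τ ^ 2 ≤ 0.55324 ^ 2 := by gcongr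
  have hR : 0 < 8 / (5 * τ ^ 2) := by positivity
  refine ⟨binaryPath (τ ^ 3) (8 / (5 * τ ^ 2)) (13 / 10), binaryPath_inAdm (by norm_num) ?_, ?_⟩
  · rw [le_div_iff₀ (by positivity)]
    linarith
  refine (action_binaryPath_le_of_ratio (e := 169 / 512 * τ ^ 4) (by norm_num) hR ?_
    (by positivity) ?_).trans_lt (ENNReal.ofReal_lt_ofReal_iff_of_nonneg (by positivity) |>.2
      (lt_of_lt_of_le ?_ (rpow_bound_le hτ)))
  · field_simp
    norm_num
  · have : τ ^ 4 ≤ 0.55324 ^ 4 := by gcongr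
    linarith
  · have hK : (8 / (5 * τ ^ 2)) ^ 2 * (τ ^ 3) ^ 2 / 2 = 32 / 25 * τ ^ 2 := by
      field_simp
      norm_num
    have hspin : (π / 4 + τ ^ 3) ^ 2 ≤ (3.141593 / 4 + 0.55324 ^ 3) ^ 2 := by gcongr
    have hquad : 5 * τ ^ 2 / 8 * (169 / 512 * τ ^ 4 + 4 / 5 * (169 / 512 * τ ^ 4) ^ 2) ≤
        5 * 0.55324 ^ 2 / 8 * (169 / 512 * 0.55324 ^ 4 + 4 / 5 * (169 / 512 * 0.55324 ^ 4) ^ 2) := by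
      gcongr
    rw [hK, inv_div]
    norm_num at hspin hquad hτ2 ⊢
    linarith

end
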